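/- Let G = (V, E, w) be a finite directed weighted graph containing at least one cycle, let o ∈ V be a source vertex from which every vertex of V is reachable, and let v* attain the minimum in Karp's formula μ* = min_{v ∈ V} max_{0 ≤ k ≤ |V| − 1} (F(|V|, v) − F(k, v)) / (|V| − k). Then: (a) there exists a path p* = ⟨i₀*, i₁*, …, i_{|V|}*⟩ from o to v* with exactly |V| edges and weight F(|V|, v*) < ∞; (b) any such p* contains a simple cycle; and (c) if c* = ⟨i_α*, i_{α+1}*, …, i_β*, i_α*⟩ is the first simple cycle occurring in p* (so that i₀*, …, i_β* are pairwise distinct), then c* is a simple minimum-mean cycle of G, i.e., w̄(c*) = μ*, and its preceding prefix ⟨i₀*, …, i_α*⟩ is a simple path meeting c* only at i_α*. -/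

import Mathlib

/-- `p` is a path (walk) in the directed graph with edge relation `E`:
a nonempty list of vertices with consecutive vertices joined by edges. -/
def IsWalk {V : Type*} (E : V → V → Prop) (p : List V) : Prop :=
  p ≠ [] ∧ p.Chain' E

/-- The multiset of edges of a path, counted with multiplicity. -/
def edgeMS {V : Type*} (p : List V) : Multiset (V × V) :=
  ↑(p.zip p.tail)

/-- The number of edges ψ(p) of a path. -/
def numEdges {V : Type*} (p : List V) : ℕ := p.length - 1

/-- The weight of a path: the sum of the weights of its edges. -/
def pathWeight {V : Type*} (w : V → V → ℝ) (p : List V) : ℝ :=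
  ((p.zip p.tail).map (fun e => w e.1 e.2)).sum

/-- A cycle: a path with at least one edge whose first and last vertices coincide. -/
def IsCycle {V : Type*} (E : V → V → Prop) (p : List V) : Prop :=
  IsWalk E p ∧ 2 ≤ p.length ∧ p.head? = p.getLast?

/-- A simple cycle: a cycle ⟨v₀, …, v_k, v₀⟩ whose vertices v₀, …, v_k are pairwise
distinct (i.e. no repeated vertices except first = last). -/
def IsSimpleCycle {V : Type*} (E : V → V → Prop) (p : List V) : Prop :=
  IsCycle E p ∧ p.dropLast.Nodup

/-- The mean weight w̄(c) = w(c)/ψ(c) of a cycle (or path). -/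
noncomputable def meanWeight {V : Type*} (w : V → V → ℝ) (p : List V) : ℝ :=
  pathWeight w p / (numEdges p : ℝ)


/-- `FVal E w o k v` is Karp's quantity `F(k, v)`: the minimum weight over all
paths from the source `o` to `v` having exactly `k` edges, and `+∞` (the top
element of `EReal`) if no such path exists. -/
noncomputable def FVal {V : Type*} (E : V → V → Prop) (w : V → V → ℝ) (o : V)
    (k : ℕ) (v : V) : EReal :=
  sInf {x : EReal | ∃ p : List V, IsWalk E p ∧ p.head? = some o ∧
    p.getLast? = some v ∧ numEdges p = k ∧ x = (pathWeight w p : EReal)}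

theorem exists_eq_append_cons_append_cons {V : Type*} {p : List V} {α β : ℕ} (hαβ : α ≤ β)
    (hβ : β + 1 < p.length) (h : p[β + 1]? = p[α]?) :
    ∃ (A B C : List V) (x : V), p = A ++ x :: (B ++ x :: C) ∧ A.length = α ∧
      B.length = β - α := by
  have hα : α < p.length := by omega
  rw [List.getElem?_eq_getElem hβ, List.getElem?_eq_getElem hα, Option.some_inj] at h
  refine ⟨p.take α, (p.drop (α + 1)).take (β - α), p.drop (β + 2), p[α], ?_, ?_, ?_⟩
  · have h₁ : p.drop (β + 1) = p[α] :: p.drop (β + 2) := by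
      rw [List.drop_eq_getElem_cons hβ, h]
    have h₂ : p.drop (β + 1) = (p.drop (α + 1)).drop (β - α) := by
      rw [List.drop_drop]; congr 1; omega
    rw [← h₁, h₂, List.take_append_drop, ← List.drop_eq_getElem_cons hα, List.take_append_drop]
  · rw [List.length_take]; omega
  · rw [List.length_take, List.length_drop]; omega

theorem pathWeight_cons_cons {V : Type*} (w : V → V → ℝ) (x y : V) (l : List V) :
    pathWeight w (x :: y :: l) = w x y + pathWeight w (y :: l) := by
  simp [pathWeight]

theorem pathWeight_append_cons {V : Type*} (w : V → V → ℝ) (A : List V) (x : V) (B : List V) :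
    pathWeight w (A ++ x :: B) = pathWeight w (A ++ [x]) + pathWeight w (x :: B) := by
  induction A with
  | nil => simp [pathWeight]
  | cons a A ih =>
    cases A with
    | nil => simp [pathWeight]
    | cons b A =>
      simp only [List.cons_append, pathWeight_cons_cons] at ih ⊢
      rw [ih, add_assoc]

theorem isSimpleCycle_of_isWalk_append {V : Type*} {E : V → V → Prop} {A B C : List V} {x : V}
    (hp : IsWalk E (A ++ x :: (B ++ x :: C))) (hnd : (A ++ x :: B).Nodup) :
    IsSimpleCycle E (x :: (B ++ [x])) := by
  have hinf : x :: (B ++ [x]) <:+: A ++ x :: (B ++ x :: C) := ⟨A, C, by simp⟩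
  refine ⟨⟨⟨by simp, List.IsChain.infix hp.2 hinf⟩, by simp, ?_⟩, ?_⟩
  · rw [← List.cons_append, List.getLast?_concat, List.head?_append]
    rfl
  · rw [← List.cons_append, List.dropLast_concat]
    exact hnd.of_append_right

theorem isWalk_append_of_isWalk_append {V : Type*} {E : V → V → Prop} {A B C : List V} {x : V}
    (hp : IsWalk E (A ++ x :: (B ++ x :: C))) : IsWalk E (A ++ x :: C) := by
  have hp2 : List.IsChain E (A ++ x :: (B ++ x :: C)) := hp.2
  refine ⟨by simp, ?_⟩
  rw [List.isChain_split] at hp2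
  exact List.isChain_split.2 ⟨hp2.1, hp2.2.infix ⟨x :: B, [], by simp⟩⟩

theorem exists_first_repeat {V : Type*} {p : List V} (hp : ¬ p.Nodup) :
    ∃ (A B C : List V) (x : V), p = A ++ x :: (B ++ x :: C) ∧ (A ++ x :: B).Nodup := by
  induction p using List.reverseRecOn with
  | nil => simp at hp
  | append_singleton l a ih =>
    by_cases hl : l.Nodup
    · have ha : a ∈ l := by
        by_contra ha
        exact hp (List.nodup_append.2 ⟨hl, by simp, by
          intro x hx y hy; rw [List.mem_singleton.1 hy]; rintro rfl; exact ha hx⟩)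
      obtain ⟨A, B, rfl⟩ := List.append_of_mem ha
      exact ⟨A, B, [], a, by simp, hl⟩
    · obtain ⟨A, B, C, x, rfl, h⟩ := ih hl
      exact ⟨A, B, C ++ [a], x, by simp, h⟩

theorem finite_setOf_pathWeight {V : Type*} [Finite V] (E : V → V → Prop) (w : V → V → ℝ) (o : V)
    (k : ℕ) (v : V) :
    {x : EReal | ∃ p : List V, IsWalk E p ∧ p.head? = some o ∧
      p.getLast? = some v ∧ numEdges p = k ∧ x = (pathWeight w p : EReal)}.Finite := by
  refine ((List.finite_length_eq V (k + 1)).image fun p => (pathWeight w p : EReal)).subset ?_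
  rintro x ⟨p, hp, -, -, hk, rfl⟩
  refine ⟨p, ?_, rfl⟩
  have := List.length_pos_of_ne_nil hp.1
  simp only [numEdges] at hk
  simp only [Set.mem_ofPred_eq]
  omega

theorem exists_isWalk_pathWeight_eq_FVal {V : Type*} [Finite V] {E : V → V → Prop}
    {w : V → V → ℝ} {o : V} {k : ℕ} {v : V} (h : FVal E w o k v ≠ ⊤) :
    ∃ p : List V, IsWalk E p ∧ p.head? = some o ∧ p.getLast? = some v ∧
      numEdges p = k ∧ (pathWeight w p : EReal) = FVal E w o k v := by
  have hne : {x : EReal | ∃ p : List V, IsWalk E p ∧ p.head? = some o ∧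
      p.getLast? = some v ∧ numEdges p = k ∧ x = (pathWeight w p : EReal)}.Nonempty := by
    by_contra hempty
    rw [Set.not_nonempty_iff_eq_empty] at hempty
    exact h (by rw [FVal, hempty, sInf_empty])
  obtain ⟨p, h₁, h₂, h₃, h₄, h₅⟩ := hne.csInf_mem (finite_setOf_pathWeight E w o k v)
  exact ⟨p, h₁, h₂, h₃, h₄, h₅.symm⟩

theorem FVal_le_pathWeight {V : Type*} {E : V → V → Prop} (w : V → V → ℝ) {o v : V}
    {p : List V} (hp : IsWalk E p) (ho : p.head? = some o) (hv : p.getLast? = some v) :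
    FVal E w o (numEdges p) v ≤ pathWeight w p :=
  sInf_le ⟨p, hp, ho, hv, rfl, rfl⟩

/-- Theorem 3, construction of a simple MMC from Karp's
formula. Let `G` be a finite directed weighted graph with at least one cycle,
`o` a source from which every vertex is reachable, `μ` the minimum mean cycle
weight, and `v*` a vertex attaining the minimum in Karp's formula (the inner
maximum at `v*` equals `μ`, with `F(|V|, v*) < ∞`). Then:
(a) there is a path `p*` from `o` to `v*` with exactly `|V|` edges and weight
`F(|V|, v*)`; (b) any such `p*` contains a simple cycle (as an infix); and
(c) if `c* = ⟨p*_α, …, p*_β, p*_α⟩` is the first simple cycle in `p*` (i.e.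
`p*_0, …, p*_β` are pairwise distinct and `p*_{β+1} = p*_α`), then `c*` is a
simple minimum-mean cycle, `w̄(c*) = μ`, and the prefix `⟨p*_0, …, p*_α⟩` is a
simple path meeting `c*` only at its last vertex. -/
theorem stmt12 {V : Type*} [Fintype V] (E : V → V → Prop) (w : V → V → ℝ) (o : V)
    (hreach : ∀ v : V, ∃ p : List V,
      IsWalk E p ∧ p.head? = some o ∧ p.getLast? = some v)
    (hcyc : ∃ c : List V, IsCycle E c)
    (μ : ℝ) (hμ : IsLeast {m : ℝ | ∃ c, IsCycle E c ∧ m = meanWeight w c} μ)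
    (vstar : V) (hfin : FVal E w o (Fintype.card V) vstar ≠ ⊤)
    (hvstar : IsGreatest {s : ℝ | ∃ k ≤ Fintype.card V - 1, FVal E w o k vstar ≠ ⊤ ∧
        s = ((FVal E w o (Fintype.card V) vstar).toReal - (FVal E w o k vstar).toReal) /
            ((Fintype.card V : ℝ) - (k : ℝ))} μ) :
    -- (a) existence of a |V|-edge path p* from o to v* of weight F(|V|, v*)
    (∃ p : List V, IsWalk E p ∧ p.head? = some o ∧ p.getLast? = some vstar ∧
      numEdges p = Fintype.card V ∧
      (pathWeight w p : EReal) = FVal E w o (Fintype.card V) vstar) ∧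
    -- (b) any such path contains a simple cycle
    (∀ p : List V, IsWalk E p → p.head? = some o → p.getLast? = some vstar →
      numEdges p = Fintype.card V →
      (pathWeight w p : EReal) = FVal E w o (Fintype.card V) vstar →
      ∃ c : List V, IsSimpleCycle E c ∧ c <:+: p) ∧
    -- (c) the first simple cycle in such a path is a simple MMC whose preceding
    -- prefix is a simple path meeting the cycle only at its last vertex
    (∀ p : List V, IsWalk E p → p.head? = some o → p.getLast? = some vstar →
      numEdges p = Fintype.card V →
      (pathWeight w p : EReal) = FVal E w o (Fintype.card V) vstar →
      ∀ α β : ℕ, α ≤ β → β + 1 < p.length →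
        (p.take (β + 1)).Nodup → p[β + 1]? = p[α]? →
        IsSimpleCycle E ((p.drop α).take (β + 2 - α)) ∧
        meanWeight w ((p.drop α).take (β + 2 - α)) = μ ∧
        IsWalk E (p.take (α + 1)) ∧ (p.take (α + 1)).Nodup ∧
        (∀ x ∈ (p.take (α + 1)).dropLast, x ∉ (p.drop α).take (β + 2 - α))) := by
  refine ⟨exists_isWalk_pathWeight_eq_FVal hfin, ?_, ?_⟩
  · intro p hp _ _ hn _
    have hnd : ¬ p.Nodup := by
      intro hnd
      have h₁ := hnd.length_le_card
      have h₂ := List.length_pos_of_ne_nil hp.1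
      simp only [numEdges] at hn
      omega
    obtain ⟨A, B, C, x, rfl, h⟩ := exists_first_repeat hnd
    exact ⟨_, isSimpleCycle_of_isWalk_append hp h, A, C, by simp⟩
  · intro p hp ho hv hn hF α β hαβ hβ hnd hrep
    obtain ⟨A, B, C, x, rfl, hA, hB⟩ := exists_eq_append_cons_append_cons hαβ hβ hrep
    have htake : (A ++ x :: (B ++ x :: C)).take (β + 1) = A ++ x :: B := by
      rw [show β + 1 = (A ++ x :: B).length by simp; omega]
      rw [show A ++ x :: (B ++ x :: C) = A ++ x :: B ++ x :: C by simp, List.take_left]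
    have hcycle : ((A ++ x :: (B ++ x :: C)).drop α).take (β + 2 - α) = x :: (B ++ [x]) := by
      rw [show β + 2 - α = (x :: (B ++ [x])).length by simp; omega, ← hA, List.drop_left,
        show x :: (B ++ x :: C) = x :: (B ++ [x]) ++ C by simp, List.take_left]
    have hprefix : (A ++ x :: (B ++ x :: C)).take (α + 1) = A ++ [x] := by
      rw [show α + 1 = (A ++ [x]).length by simp [hA],
        show A ++ x :: (B ++ x :: C) = A ++ [x] ++ (B ++ x :: C) by simp, List.take_left]
    rw [htake] at hnd
    rw [hcycle, hprefix]
    have hc := isSimpleCycle_of_isWalk_append hp hnd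
    have hnd' := List.nodup_append.1 hnd
    refine ⟨hc, ?_, ⟨by simp, List.IsChain.infix hp.2 ⟨[], B ++ x :: C, by simp⟩⟩,
      hnd.sublist (by simp), ?_⟩
    · have hlow : μ ≤ meanWeight w (x :: (B ++ [x])) := hμ.2 ⟨_, hc.1, rfl⟩
      have hwalk := isWalk_append_of_isWalk_append hp
      have hle := FVal_le_pathWeight w (o := o) (v := vstar) hwalk
        (by cases A <;> simpa using ho) (by
          rw [show A ++ x :: (B ++ x :: C) = A ++ x :: B ++ x :: C by simp,
            List.getLast?_append_of_ne_nil _ (by simp)] at hv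
          rwa [List.getLast?_append_of_ne_nil _ (by simp)])
      have hnc : numEdges (x :: (B ++ [x])) = B.length + 1 := by simp [numEdges]
      have hnn : numEdges (A ++ x :: C) + (B.length + 1) = Fintype.card V := by
        rw [← hn]; simp [numEdges]; omega
      have hne : FVal E w o (numEdges (A ++ x :: C)) vstar ≠ ⊤ :=
        ne_top_of_le_ne_top (EReal.coe_ne_top _) hle
      have hup := hvstar.2 ⟨numEdges (A ++ x :: C), by omega, hne, rfl⟩
      obtain ⟨q, -, -, -, -, hq⟩ := exists_isWalk_pathWeight_eq_FVal hne
      rw [← hq, EReal.coe_le_coe_iff] at hle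
      have hsplit : pathWeight w (A ++ x :: (B ++ x :: C)) =
          pathWeight w (A ++ x :: C) + pathWeight w (x :: (B ++ [x])) := by
        have h := pathWeight_append_cons w (x :: B) x C
        simp only [List.cons_append] at h
        rw [pathWeight_append_cons, h, pathWeight_append_cons w A x C]
        ring
      have hcard : (Fintype.card V : ℝ) - (numEdges (A ++ x :: C) : ℝ) = (B.length + 1 : ℝ) := by
        rw [← hnn]; push_cast; ring
      rw [← hq, ← hF, EReal.toReal_coe, EReal.toReal_coe, hcard] at hup
      refine le_antisymm (le_trans ?_ hup) hlow
      rw [meanWeight, hnc]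
      push_cast
      gcongr
      linarith
    · rw [List.dropLast_concat]
      intro y hy hy'
      refine hnd'.2.2 y hy y ?_ rfl
      simpa [or_comm] using hy'
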